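/- Let P₁ and P₂ be sets of probability distributions on ℝ such that sup_{p,p'∈P₁} d_KS(p,p') ≤ d_L, sup_{p,p'∈P₂} d_KS(p,p') ≤ d_L, inf_{p∈P₁,p'∈P₂} d_KS(p,p') ≥ d_H, and d_L < d_H; set Δ = d_H − d_L. Let x₁, x₂, x₃ be mutually independent sequences of n i.i.d. samples drawn from p₁ ∈ P₁, p₂ ∈ P₂, p₃ ∈ P₁ respectively. Then P(d_KS(x₁,x₃) ≥ d_KS(x₂,x₃)) ≤ 6·exp(−nΔ²/8). -/

import Mathlib

open MeasureTheory
open scoped Classical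

/-- Empirical c.d.f. of a sequence of `n` real samples. -/
noncomputable def empCDF {n : ℕ} (x : Fin n → ℝ) (a : ℝ) : ℝ :=
  (Finset.univ.filter fun i => x i ≤ a).card / (n : ℝ)

/-- KS distance between the empirical c.d.f.'s of two sequences. -/
noncomputable def ksDistSeq {n : ℕ} (x y : Fin n → ℝ) : ℝ :=
  ⨆ a : ℝ, |empCDF x a - empCDF y a|

/-- c.d.f. of a measure on ℝ. -/
noncomputable def cdfOf (p : Measure ℝ) (a : ℝ) : ℝ := (p (Set.Iic a)).toReal

/-- KS distance between two distributions on ℝ. -/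
noncomputable def ksDist (p q : Measure ℝ) : ℝ :=
  ⨆ a : ℝ, |cdfOf p a - cdfOf q a|

/-- The sign `±1` encoded by a Boolean. -/
def boolSign (b : Bool) : ℝ := if b then 1 else -1

/-- The maximum over all prefixes (including the empty one) of the `±1`-walk with steps `b`. -/
def walkMax : (N : ℕ) → (Fin N → Bool) → ℕ
  | 0, _ => 0
  | N + 1, b => if b 0 then walkMax N (Fin.tail b) + 1 else walkMax N (Fin.tail b) - 1

theorem sum_bool_fin_succ {M : Type*} [AddCommMonoid M] (N : ℕ) (φ : (Fin (N + 1) → Bool) → M) :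
    ∑ b, φ b = ∑ b : Fin N → Bool, (φ (Fin.cons true b) + φ (Fin.cons false b)) := by
  rw [← (Fin.consEquiv (fun _ : Fin (N + 1) => Bool)).sum_comp, Fintype.sum_prod_type,
    Finset.sum_add_distrib]
  simp [Fin.consEquiv]

theorem walkMax_cons (N : ℕ) (c : Bool) (b : Fin N → Bool) :
    walkMax (N + 1) (Fin.cons c b) = if c then walkMax N b + 1 else walkMax N b - 1 := by
  simp [walkMax]

/-- The law of the maximum of the simple random walk. -/
theorem sum_walkMax_eq (N r : ℕ) :
    ∑ b : Fin N → Bool, (if walkMax N b = r then 1 else 0) = N.choose ((N + r + 1) / 2) := by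
  induction N generalizing r with
  | zero =>
    rcases r with _ | r
    · simp [walkMax]
    · rw [Nat.choose_eq_zero_of_lt (by omega)]
      simp [walkMax]
  | succ N ih =>
    rw [sum_bool_fin_succ]
    simp only [walkMax_cons, if_true, Bool.false_eq_true, if_false]
    rcases r with _ | r
    · have key : ∀ b : Fin N → Bool, ((if walkMax N b + 1 = 0 then 1 else 0) +
          (if walkMax N b - 1 = 0 then 1 else 0) : ℕ) =
          (if walkMax N b = 0 then 1 else 0) + (if walkMax N b = 1 then 1 else 0) := by
        intro b
        rcases walkMax N b with _ | _ | m <;> simp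
      rw [Finset.sum_congr rfl fun b _ => key b, Finset.sum_add_distrib, ih, ih]
      rw [show (N + 1 + 0 + 1) / 2 = N / 2 + 1 by omega, Nat.choose_succ_succ]
      congr 1
      exact Nat.choose_symm_of_eq_add (by omega)
    · have key : ∀ b : Fin N → Bool, ((if walkMax N b + 1 = r + 1 then 1 else 0) +
          (if walkMax N b - 1 = r + 1 then 1 else 0) : ℕ) =
          (if walkMax N b = r then 1 else 0) + (if walkMax N b = r + 2 then 1 else 0) := by
        intro b
        split_ifs <;> omega
      rw [Finset.sum_congr rfl fun b _ => key b, Finset.sum_add_distrib, ih, ih]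
      have h1 : (N + 1 + (r + 1) + 1) / 2 = (N + r + 1) / 2 + 1 := by omega
      have h2 : (N + (r + 2) + 1) / 2 = (N + r + 1) / 2 + 1 := by omega
      rw [h1, h2, Nat.choose_succ_succ]

theorem sum_walkMax_succ (N : ℕ) :
    ∑ b, walkMax (N + 1) b = 2 * ∑ b, walkMax N b + N.choose ((N + 1) / 2) := by
  rw [← Nat.add_zero N, Nat.add_zero N, ← sum_walkMax_eq N 0, sum_bool_fin_succ, Finset.mul_sum,
    ← Finset.sum_add_distrib]
  refine Finset.sum_congr rfl fun b _ => ?_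
  simp only [walkMax_cons, if_true, Bool.false_eq_true, if_false]
  split_ifs <;> omega

theorem sum_walkMax_two_mul_le (n : ℕ) :
    ∑ b, walkMax (2 * n) b ≤ 2 * n * n.centralBinom := by
  induction n with
  | zero => simp [walkMax]
  | succ n ih =>
    have e : 2 * (n + 1) = 2 * n + 1 + 1 := by ring
    have h1 : (2 * n).choose ((2 * n + 1) / 2) = n.centralBinom := by
      rw [Nat.centralBinom]
      congr 1
      omega
    have h2 : 2 * (2 * n + 1).choose ((2 * n + 1 + 1) / 2) = (n + 1).centralBinom := by
      rw [Nat.centralBinom, e, Nat.choose_succ_succ,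
        show (2 * n + 1 + 1) / 2 = n + 1 by omega, ← Nat.choose_symm_half n]
      ring
    have h3 := Nat.succ_mul_centralBinom_succ n
    have h4 : (n + 1).centralBinom ≤ 4 * n.centralBinom := by nlinarith
    rw [e, sum_walkMax_succ, sum_walkMax_succ, h1, ← e]
    rw [← e] at h2
    nlinarith

theorem centralBinom_sq_mul_le (n : ℕ) : n.centralBinom ^ 2 * (3 * n + 1) ≤ 16 ^ n := by
  induction n with
  | zero => simp
  | succ n ih =>
    have h3 := Nat.succ_mul_centralBinom_succ n
    have h : (n + 1) ^ 2 * ((n + 1).centralBinom ^ 2 * (3 * (n + 1) + 1)) ≤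
        (n + 1) ^ 2 * 16 ^ (n + 1) := by
      calc (n + 1) ^ 2 * ((n + 1).centralBinom ^ 2 * (3 * (n + 1) + 1))
          = ((n + 1) * (n + 1).centralBinom) ^ 2 * (3 * (n + 1) + 1) := by ring
        _ = n.centralBinom ^ 2 * (4 * ((2 * n + 1) ^ 2 * (3 * n + 4))) := by rw [h3]; ring
        _ ≤ n.centralBinom ^ 2 * (4 * ((2 * n + 2) ^ 2 * (3 * n + 1))) := by
            have : (2 * n + 1) ^ 2 * (3 * n + 4) ≤ (2 * n + 2) ^ 2 * (3 * n + 1) := by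
              ring_nf
              omega
            gcongr
        _ = (n + 1) ^ 2 * 16 * (n.centralBinom ^ 2 * (3 * n + 1)) := by ring
        _ ≤ (n + 1) ^ 2 * 16 * 16 ^ n := by gcongr
        _ = (n + 1) ^ 2 * 16 ^ (n + 1) := by ring
    exact Nat.le_of_mul_le_mul_left h (by positivity)

/-- The mean of the maximum of a simple random walk of length `2 n` is at most `√(4 n / 3)`. -/
theorem sum_walkMax_two_mul_le_sqrt (n : ℕ) :
    (∑ b, walkMax (2 * n) b : ℝ) ≤ 4 ^ n * √(4 * n / 3) := by
  have h1 : (∑ b, walkMax (2 * n) b : ℝ) ≤ 2 * n * n.centralBinom := by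
    exact_mod_cast sum_walkMax_two_mul_le n
  have h2 : (n.centralBinom : ℝ) ^ 2 * (3 * n + 1) ≤ 16 ^ n := by
    exact_mod_cast centralBinom_sq_mul_le n
  refine h1.trans (abs_le_of_sq_le_sq' ?_ (by positivity)).2
  rw [mul_pow (4 ^ n : ℝ), Real.sq_sqrt (by positivity), ← pow_mul, mul_comm n 2, pow_mul]
  norm_num
  have : (0 : ℝ) ≤ n := by positivity
  have h3 : (n.centralBinom : ℝ) ^ 2 * (3 * n) ≤ 16 ^ n := by nlinarith [sq_nonneg (n.centralBinom : ℝ)]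
  nlinarith

/-- Sums over sublevel sets of a monotone sequence are prefix sums of the walk. -/
theorem sum_boolSign_le_walkMax (N : ℕ) (w : Fin N → ℝ) (hw : Monotone w) (b : Fin N → Bool)
    (a : ℝ) : (∑ k, boolSign (b k) * if w k ≤ a then 1 else 0) ≤ walkMax N b := by
  induction N with
  | zero => simp [walkMax]
  | succ N ih =>
    by_cases h0 : w 0 ≤ a
    · rw [Fin.sum_univ_succ, if_pos h0]
      refine (add_le_add le_rfl (ih (Fin.tail w)
        (fun i j hij => hw (Fin.succ_le_succ_iff.2 hij)) (Fin.tail b))).trans ?_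
      have h2 : ((walkMax N (Fin.tail b) : ℕ) : ℝ) ≤ ((walkMax N (Fin.tail b) - 1 : ℕ) : ℝ) + 1 := by
        exact_mod_cast (by omega)
      rcases hb : b 0
      · simp only [walkMax, hb, boolSign, Bool.false_eq_true, if_false]
        linarith
      · simp only [walkMax, hb, boolSign, if_true]
        push_cast
        linarith
    · rw [Finset.sum_eq_zero]
      · positivity
      · intro k _
        have : ¬ w k ≤ a := fun h => h0 ((hw (Fin.zero_le k)).trans h)
        simp [this]

theorem exists_equiv_sum_boolSign_le_walkMax {ι : Type*} [Fintype ι] {N : ℕ}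
    (hN : Fintype.card ι = N)
    (z : ι → ℝ) : ∃ e : Fin N ≃ ι, ∀ (b : ι → Bool) (a : ℝ),
      (∑ j, boolSign (b j) * if z j ≤ a then 1 else 0) ≤ walkMax N (b ∘ e) := by
  let e₀ := (Fintype.equivFinOfCardEq hN).symm
  refine ⟨(Tuple.sort (z ∘ e₀)).trans e₀, fun b a => ?_⟩
  rw [← ((Tuple.sort (z ∘ e₀)).trans e₀).sum_comp]
  exact sum_boolSign_le_walkMax N _ (Tuple.monotone_sort (z ∘ e₀)) _ a

/-- Maximal inequality for Rademacher-weighted sums of half-line indicators. -/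
theorem sum_iSup_boolSign_le {ι κ : Type*} [Fintype ι] [DecidableEq ι] [Nonempty κ] {n : ℕ}
    (hn : Fintype.card ι = 2 * n) (z : ι → ℝ) (q : κ → ℝ) :
    ∑ b : ι → Bool, (⨆ k, ∑ j, boolSign (b j) * if z j ≤ q k then 1 else 0) ≤
      4 ^ n * √(4 * n / 3) := by
  obtain ⟨e, he⟩ := exists_equiv_sum_boolSign_le_walkMax hn z
  refine le_trans ?_ (sum_walkMax_two_mul_le_sqrt n)
  rw [← (e.arrowCongr (Equiv.refl Bool)).sum_comp]
  refine Finset.sum_le_sum fun b _ => ciSup_le fun k => ?_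
  refine (he _ _).trans_eq ?_
  congr 2
  ext i
  simp

/-- Hoeffding's lemma in terms of the oscillation of the function. -/
theorem integral_exp_le_of_sub_le {α : Type*} [MeasurableSpace α] (μ : Measure α)
    [IsProbabilityMeasure μ] {f : α → ℝ} (hf : Measurable f) {c : ℝ}
    (hc : ∀ x y, f x - f y ≤ c) (t : ℝ) :
    ∫ x, Real.exp (t * f x) ∂μ ≤ Real.exp (t * ∫ x, f x ∂μ + t ^ 2 * c ^ 2 / 8) := by
  obtain ⟨x₀⟩ : Nonempty α := nonempty_of_isProbabilityMeasure μ
  have hbdd : BddBelow (Set.range f) := by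
    refine ⟨f x₀ - c, ?_⟩
    rintro _ ⟨y, rfl⟩
    linarith [hc x₀ y]
  have hmem : ∀ x, f x ∈ Set.Icc (⨅ y, f y) ((⨅ y, f y) + c) := by
    intro x
    have : Nonempty α := ⟨x₀⟩
    refine ⟨ciInf_le hbdd x, ?_⟩
    have : f x - c ≤ ⨅ y, f y := le_ciInf fun y => by linarith [hc x y]
    linarith
  have h := (ProbabilityTheory.hasSubgaussianMGF_of_mem_Icc hf.aemeasurable
    (Filter.Eventually.of_forall hmem : ∀ᵐ x ∂μ, _)).mgf_le t
  simp only [ProbabilityTheory.mgf, mul_sub, Real.exp_sub, integral_div] at h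
  rw [div_le_iff₀ (Real.exp_pos _), ← Real.exp_add] at h
  refine h.trans_eq ?_
  congr 1
  push_cast
  simp only [add_sub_cancel_left, div_pow, Real.norm_eq_abs, sq_abs]
  ring

theorem measurable_integral_fst {α β : Type*} [MeasurableSpace α] [MeasurableSpace β]
    (μ : Measure α) [IsProbabilityMeasure μ] {f : α × β → ℝ} (hf : Measurable f) :
    Measurable fun b => ∫ a, f (a, b) ∂μ :=
  (hf.stronglyMeasurable.integral_prod_left' (μ := μ)).measurable

theorem integrable_of_measurable_of_abs_le {α : Type*} [MeasurableSpace α] (μ : Measure α)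
    [IsProbabilityMeasure μ] {f : α → ℝ} (hf : Measurable f) {B : ℝ} (hB : ∀ x, |f x| ≤ B) :
    Integrable f μ :=
  Integrable.of_bound hf.aestronglyMeasurable B (Filter.Eventually.of_forall hB)

/-- Tensorization of exponential moment bounds. -/
theorem integral_exp_prod_le {α β : Type*} [MeasurableSpace α] [MeasurableSpace β]
    (μ : Measure α) (ν : Measure β) [IsProbabilityMeasure μ] [IsProbabilityMeasure ν]
    {f : α × β → ℝ} (hf : Measurable f) {B : ℝ} (hB : ∀ x, |f x| ≤ B) {t u v : ℝ}
    (hu : ∀ b, ∫ a, Real.exp (t * f (a, b)) ∂μ ≤ Real.exp (t * ∫ a, f (a, b) ∂μ + u))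
    (hv : ∫ b, Real.exp (t * ∫ a, f (a, b) ∂μ) ∂ν ≤
      Real.exp (t * ∫ b, ∫ a, f (a, b) ∂μ ∂ν + v)) :
    ∫ x, Real.exp (t * f x) ∂(μ.prod ν) ≤ Real.exp (t * ∫ x, f x ∂(μ.prod ν) + (u + v)) := by
  have hexp : ∀ y, |y| ≤ B → |Real.exp (t * y)| ≤ Real.exp (|t| * B) := by
    intro y hy
    rw [abs_of_pos (Real.exp_pos _)]
    refine Real.exp_le_exp.2 ((le_abs_self _).trans ?_)
    rw [abs_mul]
    gcongr
  have hmean : ∀ b, |∫ a, f (a, b) ∂μ| ≤ B := by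
    intro b
    have := norm_integral_le_of_norm_le_const (μ := μ) (f := fun a => f (a, b)) (C := B)
      (Filter.Eventually.of_forall fun a => hB _)
    simpa using this
  have hmeas : Measurable fun x => Real.exp (t * f x) := (hf.const_mul t).exp
  rw [integral_prod_symm _ (integrable_of_measurable_of_abs_le _ hf hB),
    integral_prod_symm _ (integrable_of_measurable_of_abs_le _ hmeas fun x => hexp _ (hB x))]
  have hg : Measurable fun b => ∫ a, f (a, b) ∂μ := measurable_integral_fst μ hf
  calc ∫ b, ∫ a, Real.exp (t * f (a, b)) ∂μ ∂ν
      ≤ ∫ b, Real.exp (t * ∫ a, f (a, b) ∂μ) * Real.exp u ∂ν := by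
        refine integral_mono ?_ ?_ fun b => ?_
        · refine integrable_of_measurable_of_abs_le ν
            (measurable_integral_fst μ hmeas) (B := Real.exp (|t| * B)) fun b => ?_
          have := norm_integral_le_of_norm_le_const (μ := μ)
            (f := fun a => Real.exp (t * f (a, b)))
            (Filter.Eventually.of_forall fun a => hexp _ (hB _))
          simpa using this
        · exact (integrable_of_measurable_of_abs_le ν (hg.const_mul t).exp
            fun b => hexp _ (hmean b)).mul_const _
        · rw [← Real.exp_add]
          exact hu b
    _ = (∫ b, Real.exp (t * ∫ a, f (a, b) ∂μ) ∂ν) * Real.exp u := integral_mul_const _ _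
    _ ≤ Real.exp (t * ∫ b, ∫ a, f (a, b) ∂μ ∂ν + v) * Real.exp u := by gcongr
    _ = _ := by
        rw [← Real.exp_add]
        ring_nf

/-- Bounded differences: changing one coordinate changes `f` by at most `c`. -/
def HasBoundedDiff {n : ℕ} (c : ℝ) (f : (Fin n → ℝ) → ℝ) : Prop :=
  ∀ (x : Fin n → ℝ) (i : Fin n) (y : ℝ), |f (Function.update x i y) - f x| ≤ c

theorem HasBoundedDiff.cons {n : ℕ} {c : ℝ} {f : (Fin (n + 1) → ℝ) → ℝ} (hf : HasBoundedDiff c f)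
    (a : ℝ) : HasBoundedDiff c fun x : Fin n → ℝ => f (Fin.cons a x) := by
  intro x i y
  have := hf (Fin.cons a x) i.succ y
  rwa [← Fin.cons_update] at this

theorem HasBoundedDiff.abs_sub_le {n : ℕ} {c : ℝ} {f : (Fin n → ℝ) → ℝ}
    (hf : HasBoundedDiff c f) (x y : Fin n → ℝ) : |f x - f y| ≤ n * c := by
  induction n with
  | zero => simp [Subsingleton.elim x y]
  | succ n ih =>
    have h1 := ih (hf.cons (x 0)) (Fin.tail x) (Fin.tail y)
    have h2 := hf y 0 (x 0)
    rw [← Fin.cons_self_tail y, Fin.update_cons_zero] at h2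
    simp only [Fin.cons_self_tail] at h1 h2
    refine (_root_.abs_sub_le _ (f (Fin.cons (x 0) (Fin.tail y))) _).trans ?_
    push_cast
    linarith

theorem HasBoundedDiff.integral {n : ℕ} {c : ℝ} {α : Type*} [MeasurableSpace α]
    (μ : Measure α) [IsProbabilityMeasure μ] {f : α → (Fin n → ℝ) → ℝ}
    (hf : ∀ a, HasBoundedDiff c (f a)) (hint : ∀ x, Integrable (fun a => f a x) μ) :
    HasBoundedDiff c fun x => ∫ a, f a x ∂μ := by
  intro x i y
  dsimp only
  rw [← integral_sub (hint _) (hint _)]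
  have := norm_integral_le_of_norm_le_const (μ := μ)
    (f := fun a => f a (Function.update x i y) - f a x)
    (Filter.Eventually.of_forall fun a => hf a x i y)
  simpa using this

/-- McDiarmid's bounded-differences inequality, in exponential moment form. -/
theorem HasBoundedDiff.integral_exp_le {n : ℕ} (p : Measure ℝ) [IsProbabilityMeasure p] {c : ℝ}
    {f : (Fin n → ℝ) → ℝ} (hf : HasBoundedDiff c f) (hm : Measurable f) (t : ℝ) :
    ∫ x, Real.exp (t * f x) ∂(Measure.pi fun _ => p) ≤
      Real.exp (t * ∫ x, f x ∂(Measure.pi fun _ => p) + n * (t ^ 2 * c ^ 2 / 8)) := by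
  induction n with
  | zero =>
    simp [Measure.pi_of_empty (fun _ : Fin 0 => p) 0]
  | succ n ih =>
    have hmp := measurePreserving_piFinSuccAbove (fun _ : Fin (n + 1) => p) 0
    set e := MeasurableEquiv.piFinSuccAbove (fun _ : Fin (n + 1) => ℝ) 0
    have hsymm : ∀ q, e.symm q = Fin.cons q.1 q.2 := fun q => by
      simp [e, MeasurableEquiv.piFinSuccAbove, Fin.insertNthEquiv]
    let g : ℝ × (Fin n → ℝ) → ℝ := fun q => f (e.symm q)
    have hgm : Measurable g := hm.comp e.symm.measurable
    have hgc : ∀ a x, g (a, x) = f (Fin.cons a x) := fun a x => by simp only [g, hsymm]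
    have h1 : ∀ F : (Fin (n + 1) → ℝ) → ℝ, ∫ x, F x ∂(Measure.pi fun _ => p) =
        ∫ q, F (e.symm q) ∂(p.prod (Measure.pi fun _ => p)) := fun F => by
      rw [← hmp.integral_comp' (fun q => F (e.symm q))]
      simp
    have hgB : ∀ q, |g q| ≤ |f 0| + (n + 1 : ℕ) * c := fun q => by
      have h2 := hf.abs_sub_le (e.symm q) 0
      have h3 := abs_sub_abs_le_abs_sub (f (e.symm q)) (f 0)
      simp only [g]
      linarith
    rw [h1, h1]
    have := integral_exp_prod_le p (Measure.pi fun _ : Fin n => p) hgm hgB (t := t)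
      (u := t ^ 2 * c ^ 2 / 8) (v := n * (t ^ 2 * c ^ 2 / 8)) (fun b => ?_) ?_
    · refine this.trans_eq ?_
      push_cast
      ring_nf
      rfl
    · refine integral_exp_le_of_sub_le p (hgm.comp measurable_prodMk_right) (fun x y => ?_) t
      change g (x, b) - g (y, b) ≤ c
      rw [hgc, hgc]
      have h2 := hf (Fin.cons y b) 0 x
      rw [Fin.update_cons_zero] at h2
      exact (le_abs_self _).trans h2
    · refine ih (f := fun b => ∫ a, g (a, b) ∂p) (HasBoundedDiff.integral p (fun a => ?_) fun x => ?_)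
        (measurable_integral_fst p hgm)
      · simp only [hgc]
        exact hf.cons a
      · exact integrable_of_measurable_of_abs_le p (hgm.comp measurable_prodMk_right)
          fun a => hgB _

theorem bddAbove_range_of_abs_le {κ : Type*} {f : κ → ℝ} {B : ℝ} (h : ∀ k, |f k| ≤ B) :
    BddAbove (Set.range f) := by
  refine ⟨B, ?_⟩
  rintro _ ⟨k, rfl⟩
  exact (abs_le.1 (h k)).2

theorem abs_iSup_le_of_abs_le {κ : Type*} [Nonempty κ] {f : κ → ℝ} {B : ℝ}
    (h : ∀ k, |f k| ≤ B) : |⨆ k, f k| ≤ B := by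
  obtain ⟨k⟩ := ‹Nonempty κ›
  have : Nonempty κ := ⟨k⟩
  exact abs_le.2 ⟨(abs_le.1 (h k)).1.trans (le_ciSup (bddAbove_range_of_abs_le h) k),
    ciSup_le fun k => (abs_le.1 (h k)).2⟩

theorem abs_boolSign (b : Bool) : |boolSign b| = 1 := by
  cases b <;> simp [boolSign]

theorem boolSign_not (b : Bool) : boolSign (!b) = -boolSign b := by
  cases b <;> simp [boolSign]

/-- The indicator of the half-line `(-∞, a]`. -/
noncomputable def stepFn (a x : ℝ) : ℝ := if x ≤ a then 1 else 0

theorem measurable_stepFn (a : ℝ) : Measurable (stepFn a) :=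
  Measurable.ite measurableSet_Iic measurable_const measurable_const

theorem stepFn_nonneg (a x : ℝ) : 0 ≤ stepFn a x := by
  unfold stepFn
  split_ifs <;> norm_num

theorem stepFn_le_one (a x : ℝ) : stepFn a x ≤ 1 := by
  unfold stepFn
  split_ifs <;> norm_num

theorem abs_stepFn_le (a x : ℝ) : |stepFn a x| ≤ 1 :=
  abs_le.2 ⟨by linarith [stepFn_nonneg a x], stepFn_le_one a x⟩

theorem abs_stepFn_sub_le (a x y : ℝ) : |stepFn a x - stepFn a y| ≤ 1 :=
  abs_le.2 ⟨by linarith [stepFn_nonneg a x, stepFn_le_one a y],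
    by linarith [stepFn_nonneg a y, stepFn_le_one a x]⟩

theorem integral_stepFn (p : Measure ℝ) (a : ℝ) : ∫ x, stepFn a x ∂p = cdfOf p a := by
  have : stepFn a = (Set.Iic a).indicator 1 := by
    ext x
    simp [stepFn, Set.indicator_apply]
  rw [this, integral_indicator_one measurableSet_Iic]
  rfl

theorem abs_sum_boolSign_mul_le {ι : Type*} [Fintype ι] (b : ι → Bool) {f : ι → ℝ}
    (hf : ∀ j, |f j| ≤ 1) : |∑ j, boolSign (b j) * f j| ≤ Fintype.card ι := by
  refine (Finset.abs_sum_le_sum_abs _ _).trans ?_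
  refine (Finset.sum_le_sum fun j _ => ?_).trans_eq (b := ∑ _j : ι, (1 : ℝ)) (by simp)
  rw [abs_mul, abs_boolSign, one_mul]
  exact hf j

/-- Averaging over all sign patterns bounds the symmetrized supremum. -/
theorem sum_iSup_boolSign_sub_le {ι κ : Type*} [Fintype ι] [DecidableEq ι] [Nonempty κ] {n : ℕ}
    (hn : Fintype.card ι = 2 * n) (z z' : ι → ℝ) (q : κ → ℝ) :
    ∑ b : ι → Bool, (⨆ k, ∑ j, boolSign (b j) * (stepFn (q k) (z j) - stepFn (q k) (z' j))) ≤
      4 ^ n * (2 * √(4 * n / 3)) := by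
  have hB : ∀ (b : ι → Bool) (z : ι → ℝ),
      BddAbove (Set.range fun k => ∑ j, boolSign (b j) * stepFn (q k) (z j)) := fun b z =>
    bddAbove_range_of_abs_le fun k => abs_sum_boolSign_mul_le b fun j => abs_stepFn_le _ _
  have h1 : ∀ b : ι → Bool,
      (⨆ k, ∑ j, boolSign (b j) * (stepFn (q k) (z j) - stepFn (q k) (z' j))) ≤
      (⨆ k, ∑ j, boolSign (b j) * stepFn (q k) (z j)) +
        ⨆ k, ∑ j, boolSign (!(b j)) * stepFn (q k) (z' j) := by
    intro b
    refine ciSup_le fun k => ?_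
    refine le_trans (le_of_eq ?_) (add_le_add (le_ciSup (hB b z) k)
      (le_ciSup (hB (fun j => !(b j)) z') k))
    rw [← Finset.sum_add_distrib]
    refine Finset.sum_congr rfl fun j _ => ?_
    rw [boolSign_not]
    ring
  have h2 := sum_iSup_boolSign_le hn z q
  have h3 := sum_iSup_boolSign_le hn z' q
  rw [← ((Equiv.refl ι).arrowCongr Equiv.boolNot).sum_comp] at h3
  refine (Finset.sum_le_sum fun b _ => h1 b).trans ?_
  rw [Finset.sum_add_distrib]
  refine (add_le_add h2 h3).trans_eq ?_
  ring

/-- Replacing the signs of a symmetrized supremum does not change its mean. -/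
theorem integral_iSup_boolSign_eq {ι : Type*} [Fintype ι] (μ : ι → Measure ℝ)
    [∀ j, IsProbabilityMeasure (μ j)] (s b : ι → Bool) :
    ∫ w : ι → ℝ × ℝ, (⨆ q : ℚ, ∑ j, boolSign (s j) * (stepFn q (w j).1 - stepFn q (w j).2))
        ∂(Measure.pi fun j => (μ j).prod (μ j)) =
      ∫ w : ι → ℝ × ℝ, (⨆ q : ℚ, ∑ j, boolSign (b j) * (stepFn q (w j).1 - stepFn q (w j).2))
        ∂(Measure.pi fun j => (μ j).prod (μ j)) := by
  have hmp : MeasurePreserving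
      (fun (w : ι → ℝ × ℝ) j => (if s j = b j then id else Prod.swap) (w j))
      (Measure.pi fun j => (μ j).prod (μ j)) (Measure.pi fun j => (μ j).prod (μ j)) := by
    refine measurePreserving_pi _ _ fun j => ?_
    split_ifs
    · exact MeasurePreserving.id _
    · exact Measure.measurePreserving_swap
  have hmeas : Measurable fun w : ι → ℝ × ℝ =>
      ⨆ q : ℚ, ∑ j, boolSign (b j) * (stepFn q (w j).1 - stepFn q (w j).2) :=
    Measurable.iSup fun q => Finset.measurable_sum _ fun j _ =>
      (((measurable_stepFn q).comp (measurable_fst.comp (measurable_pi_apply j))).sub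
        ((measurable_stepFn q).comp (measurable_snd.comp (measurable_pi_apply j)))).const_mul _
  conv_rhs => rw [← hmp.map_eq]
  rw [integral_map hmp.measurable.aemeasurable hmeas.aestronglyMeasurable]
  refine integral_congr_ae (Filter.Eventually.of_forall fun w => ?_)
  refine iSup_congr fun q => Finset.sum_congr rfl fun j _ => ?_
  dsimp only
  split_ifs with h
  · rw [h]; rfl
  · have : s j = !(b j) := by revert h; cases s j <;> cases b j <;> simp
    rw [this, boolSign_not, Prod.fst_swap, Prod.snd_swap]
    ring

/-- Mean of the one-sided supremum of a signed empirical process, by symmetrization. -/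
theorem integral_iSup_boolSign_le {ι : Type*} [Fintype ι] {n : ℕ}
    (hn : Fintype.card ι = 2 * n) (μ : ι → Measure ℝ) [∀ j, IsProbabilityMeasure (μ j)]
    (s : ι → Bool) {D : ℝ} (hD : ∀ a, ∑ j, boolSign (s j) * cdfOf (μ j) a ≤ D) :
    ∫ z, (⨆ q : ℚ, ∑ j, boolSign (s j) * stepFn q (z j)) ∂(Measure.pi μ) ≤
      D + 2 * √(4 * n / 3) := by
  classical
  have hstep : ∀ (q : ℚ) j, Measurable fun z : ι → ℝ => stepFn q (z j) := fun q j =>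
    (measurable_stepFn q).comp (measurable_pi_apply j)
  have hUm : Measurable fun z : ι → ℝ => ⨆ q : ℚ, ∑ j, boolSign (s j) * stepFn q (z j) :=
    Measurable.iSup fun q => Finset.measurable_sum _ fun j _ => (hstep q j).const_mul _
  have hUB : ∀ z : ι → ℝ, |⨆ q : ℚ, ∑ j, boolSign (s j) * stepFn q (z j)| ≤ Fintype.card ι :=
    fun z => abs_iSup_le_of_abs_le fun q => abs_sum_boolSign_mul_le s fun j => abs_stepFn_le _ _
  let V : (ι → Bool) → (ι → ℝ) × (ι → ℝ) → ℝ := fun b x =>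
    ⨆ q : ℚ, ∑ j, boolSign (b j) * (stepFn q (x.1 j) - stepFn q (x.2 j))
  have hVm : ∀ b, Measurable (V b) := fun b =>
    Measurable.iSup fun q => Finset.measurable_sum _ fun j _ =>
      (((hstep q j).comp measurable_fst).sub ((hstep q j).comp measurable_snd)).const_mul _
  have hVb : ∀ (b : ι → Bool) (x : (ι → ℝ) × (ι → ℝ)) (q : ℚ),
      |∑ j, boolSign (b j) * (stepFn q (x.1 j) - stepFn q (x.2 j))| ≤
      Fintype.card ι :=
    fun b x q => abs_sum_boolSign_mul_le b fun j => abs_stepFn_sub_le _ _ _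
  have hVB : ∀ b x, |V b x| ≤ Fintype.card ι := fun b x => abs_iSup_le_of_abs_le fun q => hVb b x q
  have hVi : ∀ b, Integrable (V b) ((Measure.pi μ).prod (Measure.pi μ)) := fun b =>
    integrable_of_measurable_of_abs_le _ (hVm b) (hVB b)
  have hghost : ∀ z : ι → ℝ, (⨆ q : ℚ, ∑ j, boolSign (s j) * stepFn q (z j)) ≤
      D + ∫ z', V s (z, z') ∂(Measure.pi μ) := by
    intro z
    refine ciSup_le fun q => ?_
    have hint : ∀ j, Integrable (fun z' : ι → ℝ => stepFn q (z' j)) (Measure.pi μ) := fun j =>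
      integrable_of_measurable_of_abs_le _ (hstep q j) fun z' => abs_stepFn_le _ _
    have hterm : ∀ j, Integrable
        (fun z' : ι → ℝ => boolSign (s j) * (stepFn q (z j) - stepFn q (z' j))) (Measure.pi μ) :=
      fun j => ((integrable_const _).sub (hint j)).const_mul _
    have h1 : ∫ z', ∑ j, boolSign (s j) * (stepFn q (z j) - stepFn q (z' j)) ∂(Measure.pi μ) =
        ∑ j, boolSign (s j) * stepFn q (z j) - ∑ j, boolSign (s j) * cdfOf (μ j) q := by
      rw [integral_finsetSum _ fun j _ => hterm j,
        ← Finset.sum_sub_distrib]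
      refine Finset.sum_congr rfl fun j _ => ?_
      rw [integral_const_mul, integral_sub (integrable_const _) (hint j),
        integral_comp_eval (measurable_stepFn q).aestronglyMeasurable, integral_stepFn]
      simp [mul_sub]
    have h2 : ∫ z', ∑ j, boolSign (s j) * (stepFn q (z j) - stepFn q (z' j)) ∂(Measure.pi μ) ≤
        ∫ z', V s (z, z') ∂(Measure.pi μ) := by
      refine integral_mono (integrable_finsetSum _ fun j _ => hterm j) ?_ fun z' => ?_
      · exact integrable_of_measurable_of_abs_le _ ((hVm s).comp measurable_prodMk_left)
          fun z' => hVB s _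
      · exact le_ciSup (bddAbove_range_of_abs_le fun q => hVb s (z, z') q) q
    linarith [hD q]
  have hsymm : ∀ b, ∫ x, V s x ∂((Measure.pi μ).prod (Measure.pi μ)) =
      ∫ x, V b x ∂((Measure.pi μ).prod (Measure.pi μ)) := by
    intro b
    have hmp := measurePreserving_arrowProdEquivProdArrow ℝ ℝ ι μ μ
    rw [← hmp.integral_comp' (V s), ← hmp.integral_comp' (V b)]
    exact integral_iSup_boolSign_eq μ s b
  have hmean : (4 : ℝ) ^ n * ∫ x, V s x ∂((Measure.pi μ).prod (Measure.pi μ)) ≤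
      4 ^ n * (2 * √(4 * n / 3)) := by
    calc (4 : ℝ) ^ n * ∫ x, V s x ∂((Measure.pi μ).prod (Measure.pi μ))
        = ∑ b, ∫ x, V b x ∂((Measure.pi μ).prod (Measure.pi μ)) := by
          rw [Finset.sum_congr rfl fun b _ => (hsymm b).symm]
          norm_num [hn, pow_mul]
      _ = ∫ x, ∑ b, V b x ∂((Measure.pi μ).prod (Measure.pi μ)) :=
          (integral_finsetSum _ fun b _ => hVi b).symm
      _ ≤ ∫ _, 4 ^ n * (2 * √(4 * n / 3)) ∂((Measure.pi μ).prod (Measure.pi μ)) := by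
          refine integral_mono (integrable_finsetSum _ fun b _ => hVi b) (integrable_const _)
            fun x => ?_
          exact sum_iSup_boolSign_sub_le hn x.1 x.2 (fun q : ℚ => (q : ℝ))
      _ = _ := by simp
  calc ∫ z, (⨆ q : ℚ, ∑ j, boolSign (s j) * stepFn q (z j)) ∂(Measure.pi μ)
      ≤ ∫ z, (D + ∫ z', V s (z, z') ∂(Measure.pi μ)) ∂(Measure.pi μ) :=
        integral_mono (integrable_of_measurable_of_abs_le _ hUm hUB)
          ((integrable_const _).add (hVi s).integral_prod_left) hghost
    _ = D + ∫ x, V s x ∂((Measure.pi μ).prod (Measure.pi μ)) := by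
        rw [integral_add (integrable_const _) (hVi s).integral_prod_left, integral_prod _ (hVi s)]
        simp
    _ ≤ D + 2 * √(4 * n / 3) := by
        gcongr
        exact le_of_mul_le_mul_left hmean (by positivity)

theorem abs_iSup_sub_iSup_le {κ : Type*} [Nonempty κ] {f g : κ → ℝ} {c : ℝ}
    (hf : BddAbove (Set.range f)) (hg : BddAbove (Set.range g)) (h : ∀ k, |f k - g k| ≤ c) :
    |(⨆ k, f k) - ⨆ k, g k| ≤ c := by
  have h1 : (⨆ k, f k) ≤ (⨆ k, g k) + c :=
    ciSup_le fun k => by linarith [(abs_le.1 (h k)).2, le_ciSup hg k]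
  have h2 : (⨆ k, g k) ≤ (⨆ k, f k) + c :=
    ciSup_le fun k => by linarith [(abs_le.1 (h k)).1, le_ciSup hf k]
  exact abs_le.2 ⟨by linarith, by linarith⟩

theorem exists_rat_le_iff {ι : Type*} [Finite ι] (z : ι → ℝ) (a : ℝ) :
    ∃ q : ℚ, ∀ j, z j ≤ q ↔ z j ≤ a := by
  have h : ∀ᶠ b in nhdsWithin a (Set.Ioi a), ∀ j, z j ≤ b ↔ z j ≤ a := by
    refine Filter.eventually_all.2 fun j => ?_
    by_cases hj : z j ≤ a
    · filter_upwards [self_mem_nhdsWithin] with b hb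
      exact ⟨fun _ => hj, fun _ => hj.trans (le_of_lt hb)⟩
    · filter_upwards [Ioo_mem_nhdsGT (not_le.1 hj)] with b hb
      exact ⟨fun hb' => absurd hb' (not_le.2 hb.2), fun h => absurd h hj⟩
  obtain ⟨u, hu, hs⟩ := (mem_nhdsGT_iff_exists_Ioo_subset).1 h
  obtain ⟨q, hq⟩ := exists_rat_btwn (Set.mem_Ioi.1 hu)
  exact ⟨q, hs hq⟩

theorem empCDF_eq_sum {n : ℕ} (x : Fin n → ℝ) (a : ℝ) :
    empCDF x a = (∑ i, stepFn a (x i)) / n := by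
  simp [empCDF, stepFn]

theorem empCDF_mem_Icc {n : ℕ} (x : Fin n → ℝ) (a : ℝ) : empCDF x a ∈ Set.Icc 0 1 := by
  refine ⟨by unfold empCDF; positivity, div_le_one_of_le₀ ?_ (by positivity)⟩
  exact_mod_cast (Finset.card_le_univ _).trans_eq (Fintype.card_fin n)

theorem abs_empCDF_sub_le {n : ℕ} (x y : Fin n → ℝ) (a : ℝ) : |empCDF x a - empCDF y a| ≤ 1 := by
  have h1 := empCDF_mem_Icc x a
  have h2 := empCDF_mem_Icc y a
  exact abs_le.2 ⟨by linarith [h1.1, h2.2], by linarith [h1.2, h2.1]⟩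

theorem measurable_empCDF {n : ℕ} (a : ℝ) : Measurable fun x : Fin n → ℝ => empCDF x a := by
  simp only [empCDF_eq_sum]
  exact (Finset.measurable_sum _ fun i _ =>
    (measurable_stepFn a).comp (measurable_pi_apply i)).div_const _

theorem hasBoundedDiff_empCDF {n : ℕ} (a : ℝ) :
    HasBoundedDiff (1 / n : ℝ) fun x : Fin n → ℝ => empCDF x a := by
  intro x i y
  simp only [empCDF_eq_sum]
  rw [← sub_div, ← Finset.sum_sub_distrib, Finset.sum_eq_single i, abs_div, Nat.abs_cast]
  · gcongr
    exact abs_stepFn_sub_le _ _ _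
  · intro j _ hj
    simp [Function.update_of_ne hj]
  · simp

theorem integral_empCDF {n : ℕ} (hn : 0 < n) (p : Measure ℝ) [IsProbabilityMeasure p] (a : ℝ) :
    ∫ x : Fin n → ℝ, empCDF x a ∂(Measure.pi fun _ => p) = cdfOf p a := by
  simp only [empCDF_eq_sum]
  have hi : ∀ i : Fin n, Integrable (fun x : Fin n → ℝ => stepFn a (x i))
      (Measure.pi fun _ => p) := fun i => integrable_of_measurable_of_abs_le _
    ((measurable_stepFn a).comp (measurable_pi_apply i)) fun x => abs_stepFn_le a (x i)
  rw [integral_div, integral_finsetSum _ fun i _ => hi i]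
  have : (n : ℝ) ≠ 0 := by positivity
  have h : ∀ i : Fin n, ∫ x : Fin n → ℝ, stepFn a (x i) ∂(Measure.pi fun _ => p) = cdfOf p a := by
    intro i
    rw [← integral_stepFn]
    exact integral_comp_eval (μ := fun _ : Fin n => p) (i := i)
      (measurable_stepFn a).aestronglyMeasurable
  simp only [h]
  simp
  field_simp

theorem ksDistSeq_eq_iSup_rat {n : ℕ} (x y : Fin n → ℝ) :
    ksDistSeq x y = ⨆ q : ℚ, |empCDF x q - empCDF y q| := by
  refine le_antisymm (ciSup_le fun a => ?_) (ciSup_le fun q => ?_)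
  · obtain ⟨q, hq⟩ := exists_rat_le_iff (Sum.elim x y) a
    have hx : empCDF x q = empCDF x a := by
      simp only [empCDF_eq_sum, stepFn]
      simp only [show ∀ i, x i ≤ (q : ℝ) ↔ x i ≤ a from fun i => hq (.inl i)]
    have hy : empCDF y q = empCDF y a := by
      simp only [empCDF_eq_sum, stepFn]
      simp only [show ∀ i, y i ≤ (q : ℝ) ↔ y i ≤ a from fun i => hq (.inr i)]
    rw [← hx, ← hy]
    exact le_ciSup (bddAbove_range_of_abs_le (f := fun q : ℚ => |empCDF x q - empCDF y q|)
      fun q => (abs_abs _).trans_le (abs_empCDF_sub_le x y q)) q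
  · exact le_ciSup (bddAbove_range_of_abs_le (f := fun a : ℝ => |empCDF x a - empCDF y a|)
      fun a => (abs_abs _).trans_le (abs_empCDF_sub_le x y a)) (q : ℝ)

theorem abs_ksDistSeq_le {n : ℕ} (x y : Fin n → ℝ) : |ksDistSeq x y| ≤ 1 :=
  abs_iSup_le_of_abs_le fun a => (abs_abs _).trans_le (abs_empCDF_sub_le x y a)

theorem measurable_ksDistSeq {n : ℕ} :
    Measurable fun w : (Fin n → ℝ) × (Fin n → ℝ) => ksDistSeq w.1 w.2 := by
  simp only [ksDistSeq_eq_iSup_rat]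
  exact Measurable.iSup fun q => (((measurable_empCDF q).comp measurable_fst).sub
    ((measurable_empCDF q).comp measurable_snd)).abs

theorem abs_ksDistSeq_sub_le {n : ℕ} {c : ℝ} (x y x' y' : Fin n → ℝ)
    (h : ∀ a, |(empCDF x a - empCDF y a) - (empCDF x' a - empCDF y' a)| ≤ c) :
    |ksDistSeq x y - ksDistSeq x' y'| ≤ c :=
  abs_iSup_sub_iSup_le
    (bddAbove_range_of_abs_le fun a => (abs_abs _).trans_le (abs_empCDF_sub_le x y a))
    (bddAbove_range_of_abs_le fun a => (abs_abs _).trans_le (abs_empCDF_sub_le x' y' a))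
    fun a => (abs_abs_sub_abs_le_abs_sub _ _).trans (h a)

/-- The one-sided Kolmogorov–Smirnov statistic, in the direction given by `c`. -/
noncomputable def ksOneSided {n : ℕ} (c : Bool) (x y : Fin n → ℝ) : ℝ :=
  ⨆ q : ℚ, boolSign c * (empCDF x q - empCDF y q)

theorem abs_boolSign_mul (c : Bool) (r : ℝ) : |boolSign c * r| = |r| := by
  rw [abs_mul, abs_boolSign, one_mul]

theorem abs_ksOneSided_le {n : ℕ} (c : Bool) (x y : Fin n → ℝ) : |ksOneSided c x y| ≤ 1 :=
  abs_iSup_le_of_abs_le fun q => (abs_boolSign_mul c _).trans_le (abs_empCDF_sub_le x y q)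

theorem bddAbove_ksOneSided {n : ℕ} (c : Bool) (x y : Fin n → ℝ) :
    BddAbove (Set.range fun q : ℚ => boolSign c * (empCDF x q - empCDF y q)) :=
  bddAbove_range_of_abs_le fun q => (abs_boolSign_mul c _).trans_le (abs_empCDF_sub_le x y q)

theorem measurable_ksOneSided {n : ℕ} (c : Bool) :
    Measurable fun w : (Fin n → ℝ) × (Fin n → ℝ) => ksOneSided c w.1 w.2 :=
  Measurable.iSup fun q => (((measurable_empCDF q).comp measurable_fst).sub
    ((measurable_empCDF q).comp measurable_snd)).const_mul _

theorem abs_ksOneSided_sub_le {n : ℕ} {r : ℝ} (c : Bool) (x y x' y' : Fin n → ℝ)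
    (h : ∀ a, |(empCDF x a - empCDF y a) - (empCDF x' a - empCDF y' a)| ≤ r) :
    |ksOneSided c x y - ksOneSided c x' y'| ≤ r :=
  abs_iSup_sub_iSup_le (bddAbove_ksOneSided c x y) (bddAbove_ksOneSided c x' y') fun q => by
    rw [← mul_sub, abs_boolSign_mul]
    exact h q

theorem ksDistSeq_le_max {n : ℕ} (x y : Fin n → ℝ) :
    ksDistSeq x y ≤ max (ksOneSided true x y) (ksOneSided false x y) := by
  rw [ksDistSeq_eq_iSup_rat]
  refine ciSup_le fun q => ?_
  rw [abs_eq_max_neg]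
  refine max_le_max ?_ ?_
  · refine le_trans ?_ (le_ciSup (bddAbove_ksOneSided true x y) q)
    simp [boolSign]
  · refine le_trans ?_ (le_ciSup (bddAbove_ksOneSided false x y) q)
    simp [boolSign]

theorem abs_cdfOf_sub_le_ksDist (p q : Measure ℝ) [IsProbabilityMeasure p] [IsProbabilityMeasure q]
    (a : ℝ) : |cdfOf p a - cdfOf q a| ≤ ksDist p q := by
  refine le_ciSup (f := fun a => |cdfOf p a - cdfOf q a|) (bddAbove_range_of_abs_le (B := 1)
    fun a => (abs_abs _).trans_le (abs_le.2 ?_)) a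
  have h1 : cdfOf p a ≤ 1 := measureReal_le_one (μ := p)
  have h2 : cdfOf q a ≤ 1 := measureReal_le_one (μ := q)
  have h3 : 0 ≤ cdfOf p a := ENNReal.toReal_nonneg
  have h4 : 0 ≤ cdfOf q a := ENNReal.toReal_nonneg
  exact ⟨by linarith, by linarith⟩

theorem ksDist_le_integral_ksDistSeq {n : ℕ} (hn : 0 < n) (p q : Measure ℝ)
    [IsProbabilityMeasure p] [IsProbabilityMeasure q] :
    ksDist p q ≤ ∫ w : (Fin n → ℝ) × (Fin n → ℝ), ksDistSeq w.1 w.2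
      ∂((Measure.pi fun _ => p).prod (Measure.pi fun _ => q)) := by
  set P : Measure (Fin n → ℝ) := Measure.pi fun _ => p with hP
  set Q : Measure (Fin n → ℝ) := Measure.pi fun _ => q with hQ
  refine ciSup_le fun a => ?_
  have hE : ∀ x : Fin n → ℝ, |empCDF x a| ≤ 1 := fun x => by
    rw [abs_of_nonneg (empCDF_mem_Icc x a).1]
    exact (empCDF_mem_Icc x a).2
  have i1 : Integrable (fun w : (Fin n → ℝ) × (Fin n → ℝ) => empCDF w.1 a) (P.prod Q) :=
    integrable_of_measurable_of_abs_le _ ((measurable_empCDF a).comp measurable_fst) fun w => hE _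
  have i2 : Integrable (fun w : (Fin n → ℝ) × (Fin n → ℝ) => empCDF w.2 a) (P.prod Q) :=
    integrable_of_measurable_of_abs_le _ ((measurable_empCDF a).comp measurable_snd) fun w => hE _
  have h : cdfOf p a - cdfOf q a = ∫ w, (empCDF w.1 a - empCDF w.2 a) ∂(P.prod Q) := by
    rw [integral_sub i1 i2, integral_fun_fst (fun x : Fin n → ℝ => empCDF x a),
      integral_fun_snd (fun x : Fin n → ℝ => empCDF x a), hP, hQ, integral_empCDF hn,
      integral_empCDF hn]
    simp
  rw [h]
  refine (abs_integral_le_integral_abs).trans (integral_mono (i1.sub i2).abs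
    (integrable_of_measurable_of_abs_le _ measurable_ksDistSeq fun w => abs_ksDistSeq_le _ _)
    fun w => ?_)
  exact le_ciSup (f := fun a => |empCDF w.1 a - empCDF w.2 a|) (bddAbove_range_of_abs_le
    fun a => (abs_abs _).trans_le (abs_empCDF_sub_le w.1 w.2 a)) a

theorem integral_ksOneSided_le {n : ℕ} (hn : 0 < n) (p q : Measure ℝ)
    [IsProbabilityMeasure p] [IsProbabilityMeasure q] (c : Bool) :
    ∫ w : (Fin n → ℝ) × (Fin n → ℝ), ksOneSided c w.1 w.2
      ∂((Measure.pi fun _ => p).prod (Measure.pi fun _ => q)) ≤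
      ksDist p q + 2 * √(4 * n / 3) / n := by
  have hn' : (0 : ℝ) < n := by exact_mod_cast hn
  let μ : Fin n ⊕ Fin n → Measure ℝ := Sum.elim (fun _ => p) (fun _ => q)
  have : ∀ j, IsProbabilityMeasure (μ j) := by rintro (j | j) <;> assumption
  let s : Fin n ⊕ Fin n → Bool := Sum.elim (fun _ => c) (fun _ => !c)
  have hD : ∀ a, ∑ j, boolSign (s j) * cdfOf (μ j) a ≤ n * ksDist p q := by
    intro a
    have h1 : ∑ j, boolSign (s j) * cdfOf (μ j) a =
        n * (boolSign c * (cdfOf p a - cdfOf q a)) := by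
      simp only [Fintype.sum_sum_type, s, μ, Sum.elim_inl, Sum.elim_inr, Finset.sum_const,
        Finset.card_univ, Fintype.card_fin, nsmul_eq_mul, boolSign_not]
      ring
    rw [h1]
    gcongr
    exact (le_abs_self _).trans ((abs_boolSign_mul c _).trans_le (abs_cdfOf_sub_le_ksDist p q a))
  have h := integral_iSup_boolSign_le (n := n) (by simp [two_mul]) μ s hD
  rw [← (measurePreserving_sumPiEquivProdPi_symm μ).integral_comp'] at h
  have key : ∀ w : (Fin n → ℝ) × (Fin n → ℝ),
      (⨆ r : ℚ, ∑ j, boolSign (s j) *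
        stepFn r ((MeasurableEquiv.sumPiEquivProdPi fun _ : Fin n ⊕ Fin n => ℝ).symm w j)) =
      n * ksOneSided c w.1 w.2 := by
    intro w
    rw [ksOneSided, Real.mul_iSup_of_nonneg hn'.le]
    refine iSup_congr fun r => ?_
    simp only [Fintype.sum_sum_type, s, Sum.elim_inl, Sum.elim_inr, boolSign_not,
      ← Finset.mul_sum, empCDF_eq_sum]
    field_simp
    rw [sub_eq_add_neg]
    rfl
  simp only [key, integral_const_mul] at h
  have h2 : n * (∫ w : (Fin n → ℝ) × (Fin n → ℝ), ksOneSided c w.1 w.2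
      ∂((Measure.pi fun _ => p).prod (Measure.pi fun _ => q))) ≤
      n * ksDist p q + 2 * √(4 * n / 3) := h
  refine le_of_mul_le_mul_left (h2.trans_eq ?_) hn'
  field_simp

/-- McDiarmid's inequality for a function of three independent i.i.d. sequences. -/
theorem integral_exp_prod_prod_le {n : ℕ} (p₁ p₂ p₃ : Measure ℝ) [IsProbabilityMeasure p₁]
    [IsProbabilityMeasure p₂] [IsProbabilityMeasure p₃]
    {f : (Fin n → ℝ) × ((Fin n → ℝ) × (Fin n → ℝ)) → ℝ} (hf : Measurable f) {B c₁ c₂ c₃ : ℝ}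
    (hB : ∀ ω, |f ω| ≤ B) (h₁ : ∀ y z, HasBoundedDiff c₁ fun x => f (x, y, z))
    (h₂ : ∀ x z, HasBoundedDiff c₂ fun y => f (x, y, z))
    (h₃ : ∀ x y, HasBoundedDiff c₃ fun z => f (x, y, z)) (t : ℝ) :
    ∫ ω, Real.exp (t * f ω) ∂((Measure.pi fun _ : Fin n => p₁).prod
        ((Measure.pi fun _ : Fin n => p₂).prod (Measure.pi fun _ : Fin n => p₃))) ≤
      Real.exp (t * ∫ ω, f ω ∂((Measure.pi fun _ : Fin n => p₁).prod
        ((Measure.pi fun _ : Fin n => p₂).prod (Measure.pi fun _ : Fin n => p₃))) +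
        n * (t ^ 2 * (c₁ ^ 2 + c₂ ^ 2 + c₃ ^ 2) / 8)) := by
  set P₁ : Measure (Fin n → ℝ) := Measure.pi fun _ => p₁
  set P₂ : Measure (Fin n → ℝ) := Measure.pi fun _ => p₂
  set P₃ : Measure (Fin n → ℝ) := Measure.pi fun _ => p₃
  let g : (Fin n → ℝ) × (Fin n → ℝ) → ℝ := fun w => ∫ x, f (x, w) ∂P₁
  have hgm : Measurable g := measurable_integral_fst P₁ hf
  have hi : ∀ w, Integrable (fun x => f (x, w)) P₁ := fun w =>
    integrable_of_measurable_of_abs_le _ (hf.comp measurable_prodMk_right) fun x => hB _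
  have hgB : ∀ w, |g w| ≤ B := fun w => by
    have := norm_integral_le_of_norm_le_const (μ := P₁) (f := fun x => f (x, w)) (C := B)
      (Filter.Eventually.of_forall fun x => hB _)
    simpa using this
  have hgi : ∀ z, Integrable (fun y => g (y, z)) P₂ := fun z =>
    integrable_of_measurable_of_abs_le _ (hgm.comp measurable_prodMk_right) fun x => hgB _
  have hg₂ : ∀ z, HasBoundedDiff c₂ fun y => g (y, z) := fun z =>
    HasBoundedDiff.integral P₁ (fun x => h₂ x z) fun y => hi _
  have hg₃ : HasBoundedDiff c₃ fun z => ∫ y, g (y, z) ∂P₂ :=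
    HasBoundedDiff.integral P₂
      (fun y => HasBoundedDiff.integral P₁ (fun x => h₃ x y) fun z => hi _) fun z => hgi z
  have hg := integral_exp_prod_le P₂ P₃ hgm hgB (t := t)
    (fun z => (hg₂ z).integral_exp_le p₂ (hgm.comp measurable_prodMk_right) t)
    (hg₃.integral_exp_le p₃ (measurable_integral_fst P₂ hgm) t)
  have hgint : Integrable g (P₂.prod P₃) := integrable_of_measurable_of_abs_le _ hgm hgB
  refine (integral_exp_prod_le P₁ (P₂.prod P₃) hf hB (t := t)
    (fun w => (h₁ w.1 w.2).integral_exp_le p₁ (hf.comp measurable_prodMk_right) t) hg).trans_eq ?_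
  congr 2
  ring

theorem exp_sixteen_div_fifteen_le : Real.exp (16 / 15) ≤ 3 := by
  refine le_of_pow_le_pow_left₀ (n := 15) (by norm_num) (by norm_num) ?_
  rw [← Real.exp_nat_mul]
  have : Real.exp ((15 : ℕ) * (16 / 15)) = Real.exp 1 ^ 16 := by
    rw [← Real.exp_nat_mul]
    norm_num
  rw [this]
  calc Real.exp 1 ^ 16 ≤ 2.7182818286 ^ 16 := by
        gcongr
        exact Real.exp_one_lt_d9.le
    _ ≤ 3 ^ 15 := by norm_num

/-- The one-sided statistic of the first and third sequences minus the distance between the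
second and third ones. -/
noncomputable def ksGap {n : ℕ} (c : Bool) (ω : (Fin n → ℝ) × ((Fin n → ℝ) × (Fin n → ℝ))) : ℝ :=
  ksOneSided c ω.1 ω.2.2 - ksDistSeq ω.2.1 ω.2.2

theorem measurable_ksOneSided_fst_snd_snd {n : ℕ} (c : Bool) :
    Measurable fun ω : (Fin n → ℝ) × ((Fin n → ℝ) × (Fin n → ℝ)) => ksOneSided c ω.1 ω.2.2 :=
  Measurable.iSup fun q => (((measurable_empCDF q).comp measurable_fst).sub
    ((measurable_empCDF q).comp measurable_snd.snd)).const_mul _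

theorem measurable_ksGap {n : ℕ} (c : Bool) : Measurable (ksGap (n := n) c) :=
  (measurable_ksOneSided_fst_snd_snd c).sub (measurable_ksDistSeq.comp measurable_snd)

theorem abs_ksGap_le {n : ℕ} (c : Bool) (ω : (Fin n → ℝ) × ((Fin n → ℝ) × (Fin n → ℝ))) :
    |ksGap c ω| ≤ 2 :=
  (abs_sub _ _).trans (by
    linarith [abs_ksOneSided_le c ω.1 ω.2.2, abs_ksDistSeq_le ω.2.1 ω.2.2])

theorem integral_ksGap_le {n : ℕ} (hn : 0 < n) (p₁ p₂ p₃ : Measure ℝ)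
    [IsProbabilityMeasure p₁] [IsProbabilityMeasure p₂] [IsProbabilityMeasure p₃] (c : Bool) :
    ∫ ω, ksGap c ω ∂((Measure.pi fun _ : Fin n => p₁).prod
        ((Measure.pi fun _ : Fin n => p₂).prod (Measure.pi fun _ : Fin n => p₃))) ≤
      ksDist p₁ p₃ + 2 * √(4 * n / 3) / n - ksDist p₂ p₃ := by
  have h1 := integral_ksOneSided_le hn p₁ p₃ c
  have h2 := ksDist_le_integral_ksDistSeq hn p₂ p₃
  set P₁ : Measure (Fin n → ℝ) := Measure.pi fun _ => p₁
  set P₂ : Measure (Fin n → ℝ) := Measure.pi fun _ => p₂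
  set P₃ : Measure (Fin n → ℝ) := Measure.pi fun _ => p₃
  have e1 : ∫ ω, ksOneSided c ω.1 ω.2.2 ∂(P₁.prod (P₂.prod P₃)) =
      ∫ w, ksOneSided c w.1 w.2 ∂(P₁.prod P₃) := by
    have hmp : MeasurePreserving (Prod.map id Prod.snd) (P₁.prod (P₂.prod P₃)) (P₁.prod P₃) :=
      (MeasurePreserving.id P₁).prod measurePreserving_snd
    rw [← hmp.map_eq, integral_map hmp.measurable.aemeasurable
      (measurable_ksOneSided c).aestronglyMeasurable]
    rfl
  have e2 : ∫ ω, ksDistSeq ω.2.1 ω.2.2 ∂(P₁.prod (P₂.prod P₃)) =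
      ∫ w, ksDistSeq w.1 w.2 ∂(P₂.prod P₃) := by
    rw [integral_fun_snd (fun w : (Fin n → ℝ) × (Fin n → ℝ) => ksDistSeq w.1 w.2)]
    simp
  simp only [ksGap]
  have i1 : Integrable (fun ω : (Fin n → ℝ) × ((Fin n → ℝ) × (Fin n → ℝ)) =>
      ksOneSided c ω.1 ω.2.2) (P₁.prod (P₂.prod P₃)) :=
    integrable_of_measurable_of_abs_le _ (measurable_ksOneSided_fst_snd_snd c)
      fun ω => abs_ksOneSided_le c ω.1 ω.2.2
  have i2 : Integrable (fun ω : (Fin n → ℝ) × ((Fin n → ℝ) × (Fin n → ℝ)) =>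
      ksDistSeq ω.2.1 ω.2.2) (P₁.prod (P₂.prod P₃)) :=
    integrable_of_measurable_of_abs_le _ (measurable_ksDistSeq.comp measurable_snd)
      fun ω => abs_ksDistSeq_le ω.2.1 ω.2.2
  rw [integral_sub i1 i2, e1, e2]
  linarith

theorem hasBoundedDiff_ksGap_fst {n : ℕ} (c : Bool) (y z : Fin n → ℝ) :
    HasBoundedDiff (1 / n : ℝ) fun x => ksGap c (x, y, z) := by
  intro x i v
  simp only [ksGap, sub_sub_sub_cancel_right]
  refine abs_ksOneSided_sub_le c _ _ _ _ fun a => ?_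
  rw [sub_sub_sub_cancel_right]
  exact hasBoundedDiff_empCDF a x i v

theorem hasBoundedDiff_ksGap_snd {n : ℕ} (c : Bool) (x z : Fin n → ℝ) :
    HasBoundedDiff (1 / n : ℝ) fun y => ksGap c (x, y, z) := by
  intro y i v
  simp only [ksGap, sub_sub_sub_cancel_left]
  rw [abs_sub_comm]
  refine abs_ksDistSeq_sub_le _ _ _ _ fun a => ?_
  rw [sub_sub_sub_cancel_right]
  exact hasBoundedDiff_empCDF a y i v

theorem hasBoundedDiff_ksGap_thd {n : ℕ} (c : Bool) (x y : Fin n → ℝ) :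
    HasBoundedDiff (2 / n : ℝ) fun z => ksGap c (x, y, z) := by
  intro z i v
  have hz : ∀ (x : Fin n → ℝ) (a : ℝ),
      |(empCDF x a - empCDF (Function.update z i v) a) - (empCDF x a - empCDF z a)| ≤ 1 / n := by
    intro x a
    rw [sub_sub_sub_cancel_left, abs_sub_comm]
    exact hasBoundedDiff_empCDF a z i v
  have k1 := abs_ksOneSided_sub_le c x (Function.update z i v) x z (hz x)
  have k2 := abs_ksDistSeq_sub_le y (Function.update z i v) y z (hz y)
  simp only [ksGap]
  rw [sub_sub_sub_comm]
  refine (abs_sub _ _).trans ((add_le_add k1 k2).trans_eq ?_)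
  ring

/-- One-sided comparison of the distance within a cluster and the distance across clusters. -/
theorem measure_ksDistSeq_le_ksOneSided_le {n : ℕ} (hn : 0 < n) (p₁ p₂ p₃ : Measure ℝ)
    [IsProbabilityMeasure p₁] [IsProbabilityMeasure p₂] [IsProbabilityMeasure p₃] {dL dH : ℝ}
    (hL : ksDist p₁ p₃ ≤ dL) (hH : dH ≤ ksDist p₂ p₃) (hLH : dL < dH) (c : Bool) :
    ((Measure.pi fun _ : Fin n => p₁).prod
        ((Measure.pi fun _ : Fin n => p₂).prod (Measure.pi fun _ : Fin n => p₃))).real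
        {ω | ksDistSeq ω.2.1 ω.2.2 ≤ ksOneSided c ω.1 ω.2.2} ≤
      3 * Real.exp (-(n * (dH - dL) ^ 2) / 8) := by
  have hn' : (0 : ℝ) < n := by exact_mod_cast hn
  have hthree : Real.exp (16 / 15 - n * (dH - dL) ^ 2 / 8) ≤
      3 * Real.exp (-(n * (dH - dL) ^ 2) / 8) := by
    rw [sub_eq_add_neg, Real.exp_add, neg_div]
    gcongr
    exact exp_sixteen_div_fifteen_le
  refine le_trans ?_ hthree
  set P₁ : Measure (Fin n → ℝ) := Measure.pi fun _ => p₁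
  set P₂ : Measure (Fin n → ℝ) := Measure.pi fun _ => p₂
  set P₃ : Measure (Fin n → ℝ) := Measure.pi fun _ => p₃
  set δ : ℝ := 2 * √(4 * n / 3) / n with hδ
  have hδ0 : 0 ≤ δ := by positivity
  have hδ2 : n * δ ^ 2 = 16 / 3 := by
    rw [hδ, div_pow, mul_pow, Real.sq_sqrt (by positivity)]
    field_simp
    norm_num
  rcases lt_or_ge (dH - dL) δ with hlt | hge
  · refine measureReal_le_one.trans (Real.one_le_exp ?_)
    have : n * (dH - dL) ^ 2 ≤ n * δ ^ 2 := by
      gcongr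
    linarith
  have hmean : ∫ ω, ksGap c ω ∂(P₁.prod (P₂.prod P₃)) ≤ -(dH - dL - δ) := by
    linarith [integral_ksGap_le hn p₁ p₂ p₃ c]
  obtain ⟨m, hm⟩ : ∃ m, m = dH - dL - δ := ⟨_, rfl⟩
  rw [← hm] at hmean
  have hm0 : 0 ≤ m := by linarith
  obtain ⟨t, ht⟩ : ∃ t, t = 2 * n * m / 3 := ⟨_, rfl⟩
  have ht0 : 0 ≤ t := ht ▸ by positivity
  have hexp := integral_exp_prod_prod_le (n := n) p₁ p₂ p₃ (measurable_ksGap c)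
    (abs_ksGap_le c) (hasBoundedDiff_ksGap_fst c) (hasBoundedDiff_ksGap_snd c) (hasBoundedDiff_ksGap_thd c) t
  have hint : Integrable (fun ω => Real.exp (t * ksGap c ω)) (P₁.prod (P₂.prod P₃)) := by
    refine integrable_of_measurable_of_abs_le _ ((measurable_ksGap c).const_mul t).exp
      (B := Real.exp (t * 2)) fun ω => ?_
    rw [abs_of_pos (Real.exp_pos _)]
    gcongr
    exact (abs_le.1 (abs_ksGap_le c ω)).2
  have hchernoff := ProbabilityTheory.measure_ge_le_exp_mul_mgf (X := ksGap c) 0 ht0 hint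
  simp only [mul_zero, Real.exp_zero, one_mul, ProbabilityTheory.mgf, ksGap,
    sub_nonneg] at hchernoff
  refine (hchernoff.trans hexp).trans (Real.exp_le_exp.2 ?_)
  have hvar : n * (t ^ 2 * ((1 / n : ℝ) ^ 2 + (1 / n) ^ 2 + (2 / n) ^ 2) / 8) = n * m ^ 2 / 3 := by
    rw [ht]
    field_simp
    ring
  have hlin : t * ∫ ω, ksGap c ω ∂(P₁.prod (P₂.prod P₃)) ≤ t * -m := by gcongr
  have hlin' : t * -m = -(2 * (n * m ^ 2) / 3) := by
    rw [ht]
    ring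
  have hsq : 0 ≤ n * (dH - dL - 8 / 5 * δ) ^ 2 := by positivity
  have hquad : n * m ^ 2 / 3 = n * (dH - dL) ^ 2 / 8 - n * δ ^ 2 / 5 +
      5 / 24 * (n * (dH - dL - 8 / 5 * δ) ^ 2) := by
    rw [hm]
    ring
  rw [hvar]
  linarith
/-- Lemma: three-sequence comparison under the KS distance.
If clusters `P₁, P₂` have KS-diameters at most `d_L`, are at KS distance at least `d_H`
from each other, with `d_L < d_H` and `Δ = d_H - d_L`, and `x₁, x₂, x₃` are mutually
independent sequences of `n` i.i.d. samples from `p₁ ∈ P₁`, `p₂ ∈ P₂`, `p₃ ∈ P₁`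
respectively, then `P(d_KS(x₁,x₃) ≥ d_KS(x₂,x₃)) ≤ 6 exp(-n Δ² / 8)`. -/
theorem stmt2 (P₁ P₂ : Set (Measure ℝ))
    (hP₁ : ∀ p ∈ P₁, IsProbabilityMeasure p) (hP₂ : ∀ p ∈ P₂, IsProbabilityMeasure p)
    (dL dH : ℝ)
    (hdiam₁ : ∀ p ∈ P₁, ∀ q ∈ P₁, ksDist p q ≤ dL)
    (hdiam₂ : ∀ p ∈ P₂, ∀ q ∈ P₂, ksDist p q ≤ dL)
    (hsep : ∀ p ∈ P₁, ∀ q ∈ P₂, dH ≤ ksDist p q)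
    (hLH : dL < dH)
    (n : ℕ) (p₁ p₂ p₃ : Measure ℝ) (hp₁ : p₁ ∈ P₁) (hp₂ : p₂ ∈ P₂) (hp₃ : p₃ ∈ P₁) :
    ((Measure.pi fun _ : Fin n => p₁).prod
        ((Measure.pi fun _ : Fin n => p₂).prod (Measure.pi fun _ : Fin n => p₃)))
        {ω : (Fin n → ℝ) × ((Fin n → ℝ) × (Fin n → ℝ)) |
          ksDistSeq ω.1 ω.2.2 ≥ ksDistSeq ω.2.1 ω.2.2}
      ≤ ENNReal.ofReal (6 * Real.exp (-((n : ℝ) * (dH - dL) ^ 2) / 8)) := by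
  have := hP₁ p₁ hp₁
  have := hP₂ p₂ hp₂
  have := hP₁ p₃ hp₃
  rcases Nat.eq_zero_or_pos n with rfl | hn
  · refine prob_le_one.trans ?_
    rw [ENNReal.one_le_ofReal]
    simp
  have hH : dH ≤ ksDist p₂ p₃ := by
    refine (hsep p₃ hp₃ p₂ hp₂).trans_eq ?_
    simp only [ksDist, abs_sub_comm]
  have key := fun c => measure_ksDistSeq_le_ksOneSided_le hn p₁ p₂ p₃
    (hdiam₁ p₁ hp₁ p₃ hp₃) hH hLH c
  rw [← ofReal_measureReal]
  refine ENNReal.ofReal_le_ofReal ?_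
  refine (measureReal_mono (fun ω hω => ?_)).trans
    ((measureReal_union_le _ _).trans ((add_le_add (key true) (key false)).trans_eq ?_))
  · exact le_max_iff.1 (le_trans hω (ksDistSeq_le_max _ _))
  · ring
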